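/- For every positive integer n and every nonnegative integer d, the following polynomial identity in x_1,…,x_n holds: the sum over all symmetric n×n matrices A with nonnegative integer entries summing to d of ∏_i x_i^{a_{ii}} · ∏_{i<j} (x_i x_j)^{a_{ij}} equals the sum over all partitions λ of d of the Schur polynomial s_λ(x_1,…,x_n). -/

import Mathlib

/-- The weight of a semistandard Young tableau: `ssytWeight T i` is the number of cells of the
tableau whose entry equals `i`. -/
def ssytWeight {μ : YoungDiagram} (T : SemistandardYoungTableau μ) (i : ℕ) : ℕ :=
  (μ.cells.filter fun c => T c.1 c.2 = i).card

/-- `tabCard μ ν` is the number of semistandard Young tableaux of shape `μ` and weight `ν`,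
where `ν : Fin n → ℕ`: the entry `j` (for `j < n`) occurs exactly `ν j` times, and no entry
`≥ n` occurs. -/
noncomputable def tabCard (μ : YoungDiagram) {n : ℕ} (ν : Fin n → ℕ) : ℕ :=
  Set.ncard {T : SemistandardYoungTableau μ |
    ∀ j : ℕ, ssytWeight T j = if h : j < n then ν ⟨j, h⟩ else 0}

/-- The Schur polynomial `s_μ(x_0, …, x_{n-1})`, as the generating function of semistandard
Young tableaux of shape `μ` with entries in `{0, …, n-1}`. -/
noncomputable def schurPoly (n : ℕ) (μ : YoungDiagram) : MvPolynomial (Fin n) ℤ :=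
  ∑ᶠ (T : SemistandardYoungTableau μ) (_ : ∀ c ∈ μ.cells, T c.1 c.2 < n),
    ∏ i : Fin n, (MvPolynomial.X i : MvPolynomial (Fin n) ℤ) ^ ssytWeight T (i : ℕ)

/-- The number of odd rows (odd parts) of a Young diagram. -/
def oddRowsCount (lam : YoungDiagram) : ℕ :=
  lam.rowLens.countP fun r => r % 2 = 1

/-- The number of odd columns of a Young diagram. -/
def oddColsCount (lam : YoungDiagram) : ℕ :=
  oddRowsCount lam.transpose

/-- A Young diagram is a *threshold* partition if its Frobenius coordinates satisfy
`β i = α i + 1` for each `i` up to the Durfee rank; with 0-indexed diagrams this says that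
`colLen i = rowLen i + 1` for each diagonal cell `(i, i)`. -/
def YoungDiagram.IsThreshold (lam : YoungDiagram) : Prop :=
  ∀ i : ℕ, (i, i) ∈ lam → lam.colLen i = lam.rowLen i + 1

open scoped ENNReal

/-- The sequence `g` interlaces `f`: `f (i + 1) ≤ g i ≤ f i` for all `i`. -/
def Interlaces (g f : ℕ → ℕ) : Prop := ∀ i, f (i + 1) ≤ g i ∧ g i ≤ f i

/-- The outer shape produced by the local growth rule from the shapes `f`, `g`, the inner shape `k`
and the matrix entry `a`. -/
def growthShape (f g k : ℕ → ℕ) (a : ℕ) : ℕ → ℕ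
  | 0 => max (f 0) (g 0) + a
  | i + 1 => min (f i) (g i) + max (f (i + 1)) (g (i + 1)) - k i

/-- The local growth rule of the Robinson–Schensted–Knuth correspondence. -/
def growthEquiv (f g : ℕ → ℕ) :
    ({k // Interlaces k f ∧ Interlaces k g} × ℕ) ≃ {h // Interlaces f h ∧ Interlaces g h} where
  toFun p := ⟨growthShape f g p.1.1 p.2, by
    obtain ⟨⟨k, hf, hg⟩, a⟩ := p
    refine ⟨fun i => ?_, fun i => ?_⟩ <;> have h1 := hf i <;> have h2 := hg i <;>
      cases i with
      | zero => simp only [growthShape, zero_add] at *; omega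
      | succ i => have h3 := hf i; have h4 := hg i; simp only [growthShape]; omega⟩
  invFun h := (⟨fun i => min (f i) (g i) + max (f (i + 1)) (g (i + 1)) - h.1 (i + 1), by
    obtain ⟨h, hf, hg⟩ := h
    refine ⟨fun i => ?_, fun i => ?_⟩ <;>
      (have h1 := hf i; have h2 := hg i; have h3 := hf (i + 1); have h4 := hg (i + 1)
       simp only; omega)⟩, h.1 0 - max (f 0) (g 0))
  left_inv := by
    rintro ⟨⟨k, hf, hg⟩, a⟩
    ext i
    · have h1 := hf i; have h2 := hg i
      simp only [growthShape]; omega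
    · simp [growthShape]
  right_inv := by
    rintro ⟨h, hf, hg⟩
    ext i
    have h1 := hf i; have h2 := hg i
    cases i with
    | zero => simp only [growthShape]; omega
    | succ i => have h3 := hf i; have h4 := hg i; simp only [growthShape]; omega

lemma sum_growthEquiv (M : ℕ) {f g : ℕ → ℕ} (hf : f M = 0) (hg : g M = 0)
    (p : {k // Interlaces k f ∧ Interlaces k g} × ℕ) :
    ∑ i ∈ Finset.range (M + 1), (growthEquiv f g p).1 i + ∑ i ∈ Finset.range (M + 1), p.1.1 i =
      p.2 + ∑ i ∈ Finset.range (M + 1), f i + ∑ i ∈ Finset.range (M + 1), g i := by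
  obtain ⟨⟨k, kf, kg⟩, a⟩ := p
  have key : ∀ m, ∑ i ∈ Finset.range (m + 1), (growthEquiv f g ⟨⟨k, kf, kg⟩, a⟩).1 i +
      ∑ i ∈ Finset.range m, k i = a + ∑ i ∈ Finset.range m, f i +
        ∑ i ∈ Finset.range m, g i + max (f m) (g m) := by
    intro m
    induction m with
    | zero => simp [growthEquiv, growthShape, add_comm]
    | succ m ih =>
      rw [Finset.sum_range_succ, Finset.sum_range_succ k, Finset.sum_range_succ f,
        Finset.sum_range_succ g]
      have h1 := kf m
      have h2 := kg m
      have : (growthEquiv f g ⟨⟨k, kf, kg⟩, a⟩).1 (m + 1) =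
        min (f m) (g m) + max (f (m + 1)) (g (m + 1)) - k m := rfl
      omega
  have := key M
  have h1 := kf M
  simp only [Finset.sum_range_succ _ M, hf, hg] at this ⊢
  omega

lemma ENNReal.tsum_subtype_eq_ite {α : Type*} (p : α → Prop) [DecidablePred p] (G : α → ℝ≥0∞) :
    ∑' a : {a // p a}, G a = ∑' a, if p a then G a else 0 :=
  (tsum_subtype {a | p a} G).trans (tsum_congr fun a => by simp [Set.indicator_apply])

lemma ENNReal.tsum_subtype_comm {α β : Type*} (p : α → Prop) (q : α → β → Prop)
    (G : α → β → ℝ≥0∞) :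
    ∑' a : {a // p a}, ∑' b : {b // q a b}, G a b =
      ∑' b, ∑' a : {a // p a ∧ q a b}, G a b := by
  classical
  simp_rw [ENNReal.tsum_subtype_eq_ite (fun b => q _ b),
    fun b => ENNReal.tsum_subtype_eq_ite (fun a => p a ∧ q a b) (G · b)]
  rw [ENNReal.tsum_subtype_eq_ite p fun a => ∑' b, if q a b then G a b else 0, ENNReal.tsum_comm]
  refine tsum_congr fun a => ?_
  by_cases ha : p a <;> simp [ha]

lemma ENNReal.tsum_comm_subtype {α β : Type*} (q : α → β → Prop) (G : α → β → ℝ≥0∞) :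
    ∑' a, ∑' b : {b // q a b}, G a b = ∑' b, ∑' a : {a // q a b}, G a b := by
  classical
  simp_rw [ENNReal.tsum_subtype_eq_ite (fun b => q _ b),
    fun b => ENNReal.tsum_subtype_eq_ite (fun a => q a b) (G · b)]
  exact ENNReal.tsum_comm

/-- Weighted sum over the Gelfand–Tsetlin patterns with `n` rows and top row `f`. -/
noncomputable def gtSum (M : ℕ) : (n : ℕ) → (ℕ → ℕ) → ((Fin n → ℕ) → ℝ≥0∞) → ℝ≥0∞
  | 0, f, F => open Classical in if f = 0 then F 0 else 0
  | n + 1, f, F => ∑' g : {g // Interlaces g f}, gtSum M n g fun w =>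
      F (Fin.snoc w (∑ i ∈ Finset.range (M + 1), f i - ∑ i ∈ Finset.range (M + 1), g.1 i))

lemma gtSum_eq_zero (M n : ℕ) (f : ℕ → ℕ) (F : (Fin n → ℕ) → ℝ≥0∞) {i : ℕ} (hi : n ≤ i)
    (hf : f i ≠ 0) : gtSum M n f F = 0 := by
  induction n generalizing f i with
  | zero =>
    rw [gtSum, if_neg]
    rintro rfl
    simp at hf
  | succ n ih =>
    rw [gtSum, ENNReal.tsum_eq_zero]
    rintro ⟨g, hg⟩
    obtain ⟨i, rfl⟩ : ∃ j, i = j + 1 := ⟨i - 1, by omega⟩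
    have := hg i
    exact ih g _ (i := i) (by omega) (by omega)

lemma gtSum_congr (M n : ℕ) (f : ℕ → ℕ) {F G : (Fin n → ℕ) → ℝ≥0∞}
    (h : ∀ w, ∑ i, w i = ∑ i ∈ Finset.range (M + 1), f i → F w = G w) :
    gtSum M n f F = gtSum M n f G := by
  induction n generalizing f with
  | zero =>
    rw [gtSum, gtSum]
    split_ifs with hf
    · exact h _ (by simp [hf])
    · rfl
  | succ n ih =>
    rw [gtSum, gtSum]
    refine tsum_congr fun g => ih g fun w hw => h _ ?_
    have := Finset.sum_le_sum (s := Finset.range (M + 1)) fun i _ => (g.2 i).2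
    rw [Fin.sum_univ_castSucc]
    simp only [Fin.snoc_castSucc, Fin.snoc_last, hw]
    omega

/-- The Pieri rule, at the level of weighted sums over Gelfand–Tsetlin patterns. -/
lemma tsum_gtSum_interlaces (M n : ℕ) (hn : n ≤ M) (k : ℕ → ℕ) (F : (Fin n → ℕ) → ℝ≥0∞) :
    ∑' f : {f // Interlaces k f}, gtSum M n f F =
      ∑' b : Fin n → ℕ, gtSum M n k fun w => F (w + b) := by
  induction n generalizing k with
  | zero =>
    simp only [gtSum, tsum_fintype, Finset.univ_unique, Finset.sum_singleton]
    by_cases hk : k = 0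
    · rw [tsum_eq_single ⟨0, by subst hk; intro i; simp⟩]
      · rw [if_pos rfl, if_pos hk, zero_add]
        exact congrArg F (Subsingleton.elim _ _)
      · rintro ⟨f, hf⟩ hne
        rw [if_neg]
        rintro rfl
        exact hne rfl
    · rw [if_neg hk, ENNReal.tsum_eq_zero]
      rintro ⟨f, hf⟩
      rw [if_neg]
      rintro rfl
      exact hk (funext fun i => by simpa using (hf i).2)
  | succ n ih =>
    have hM : n ≤ M := by omega
    let s : (ℕ → ℕ) → ℕ := fun f => ∑ i ∈ Finset.range (M + 1), f i
    calc ∑' f : {f // Interlaces k f}, gtSum M (n + 1) f F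
        = ∑' f : {f // Interlaces k f}, ∑' g : {g // Interlaces g f.1}, gtSum M n g fun w =>
            F (Fin.snoc w (s f - s g)) := rfl
      _ = ∑' g, ∑' f : {f // Interlaces k f ∧ Interlaces g f}, gtSum M n g fun w =>
            F (Fin.snoc w (s f - s g)) :=
          ENNReal.tsum_subtype_comm _ (fun f g => Interlaces g f)
            fun f g => gtSum M n g fun w => F (Fin.snoc w (s f - s g))
      _ = ∑' g, ∑' l : {l // Interlaces l k ∧ Interlaces l g}, ∑' a, gtSum M n g fun w =>
            F (Fin.snoc w (s k - s l) + Fin.snoc 0 a) := by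
          refine tsum_congr fun g => ?_
          rw [← (growthEquiv k g).tsum_eq, ENNReal.tsum_prod']
          refine tsum_congr fun l => tsum_congr fun a => ?_
          by_cases hg : g M = 0
          · by_cases hk : k M = 0
            · congr 1
              ext w
              congr 1
              have h1 := sum_growthEquiv M hk hg (l, a)
              have h2 := Finset.sum_le_sum (s := Finset.range (M + 1)) fun i _ => (l.2.1 i).2
              ext i
              induction i using Fin.lastCases with
              | last => simp [s]; simp at h1; omega
              | cast i => simp
            · obtain ⟨m, rfl⟩ : ∃ j, M = j + 1 := ⟨M - 1, by omega⟩
              have h1 := l.2.1 m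
              have h2 := l.2.2 m
              rw [gtSum_eq_zero _ _ _ _ (i := m) (by omega) (by omega),
                gtSum_eq_zero _ _ _ _ (i := m) (by omega) (by omega)]
          · rw [gtSum_eq_zero _ _ _ _ hM hg, gtSum_eq_zero _ _ _ _ hM hg]
      _ = ∑' l : {l // Interlaces l k}, ∑' g : {g // Interlaces l.1 g}, ∑' a,
            gtSum M n g fun w => F (Fin.snoc w (s k - s l) + Fin.snoc 0 a) :=
          (ENNReal.tsum_subtype_comm _ Interlaces fun l g => ∑' a,
            gtSum M n g fun w => F (Fin.snoc w (s k - s l) + Fin.snoc 0 a)).symm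
      _ = ∑' l : {l // Interlaces l k}, ∑' a, ∑' b : Fin n → ℕ,
            gtSum M n l fun w => F (Fin.snoc (w + b) (s k - s l) + Fin.snoc 0 a) := by
          refine tsum_congr fun l => ?_
          rw [ENNReal.tsum_comm]
          exact tsum_congr fun a => ih hM l
            fun w => F (Fin.snoc w (s k - s l) + Fin.snoc 0 a)
      _ = ∑' a, ∑' b : Fin n → ℕ, gtSum M (n + 1) k fun w =>
            F (w + Fin.snoc b a) := by
          simp only [gtSum]
          rw [ENNReal.tsum_comm]
          refine tsum_congr fun a => ?_
          rw [ENNReal.tsum_comm]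
          refine tsum_congr fun b => tsum_congr fun l => ?_
          congr! 3 with w
          ext i
          induction i using Fin.lastCases with
          | last => simp [s]
          | cast i => simp
      _ = _ := by
          rw [← ENNReal.tsum_prod, ← (Fin.snocEquiv fun _ => ℕ).tsum_eq]
          rfl

/-- Extending a symmetric matrix by a last row and column. -/
def symmSnoc {n : ℕ} (A : Matrix (Fin n) (Fin n) ℕ) (b : Fin n → ℕ) (a : ℕ) :
    Matrix (Fin (n + 1)) (Fin (n + 1)) ℕ :=
  Fin.snoc (α := fun _ => Fin (n + 1) → ℕ) (fun i => Fin.snoc (A i) (b i)) (Fin.snoc b a)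

/-- Splitting a symmetric matrix into its corner entry, the rest of its last column, and the
remaining symmetric matrix. -/
def symmSnocEquiv (n : ℕ) :
    (ℕ × (Fin n → ℕ) × {A : Matrix (Fin n) (Fin n) ℕ // A.IsSymm}) ≃
      {A : Matrix (Fin (n + 1)) (Fin (n + 1)) ℕ // A.IsSymm} where
  toFun p := ⟨symmSnoc p.2.2.1 p.2.1 p.1, by
    refine Matrix.IsSymm.ext fun i j => ?_
    have h := p.2.2.2.apply
    induction i using Fin.lastCases <;> induction j using Fin.lastCases <;> simp [symmSnoc, h]⟩
  invFun A := (A.1 (Fin.last n) (Fin.last n), fun i => A.1 i.castSucc (Fin.last n),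
    ⟨fun i j => A.1 i.castSucc j.castSucc, Matrix.IsSymm.ext fun i j => A.2.apply _ _⟩)
  left_inv p := by simp [symmSnoc]
  right_inv A := by
    ext i j
    have h := A.2.apply
    induction i using Fin.lastCases <;> induction j using Fin.lastCases <;> simp [symmSnoc, h]

/-- The row sums of symmetric matrices are equidistributed with the weights of Gelfand–Tsetlin
patterns. -/
lemma tsum_gtSum (M n : ℕ) (hn : n ≤ M + 1) (F : (Fin n → ℕ) → ℝ≥0∞) :
    ∑' f, gtSum M n f F =
      ∑' A : {A : Matrix (Fin n) (Fin n) ℕ // A.IsSymm}, F fun i => ∑ j, A.1 i j := by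
  induction n with
  | zero =>
    simp only [gtSum]
    rw [tsum_eq_single 0 (by simp +contextual), if_pos rfl, tsum_eq_single ⟨0, rfl⟩]
    · congr 1
    · rintro ⟨A, hA⟩ hne
      exact absurd (Subtype.ext (Subsingleton.elim _ _)) hne
  | succ n ih =>
    have hM : n ≤ M := by omega
    let s : (ℕ → ℕ) → ℕ := fun f => ∑ i ∈ Finset.range (M + 1), f i
    calc ∑' f, gtSum M (n + 1) f F
        = ∑' f, ∑' g : {g // Interlaces g f}, gtSum M n g fun w =>
            F (Fin.snoc w (s f - s g)) := rfl
      _ = ∑' g, ∑' f : {f // Interlaces g f ∧ Interlaces g f}, gtSum M n g fun w =>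
            F (Fin.snoc w (s f - s g)) := by
          refine (ENNReal.tsum_comm_subtype (fun f g => Interlaces g f)
            fun f g => gtSum M n g fun w => F (Fin.snoc w (s f - s g))).trans ?_
          exact tsum_congr fun g => ((Equiv.subtypeEquivRight fun _ => and_self_iff).tsum_eq
            fun f : {f // Interlaces g f} => gtSum M n g fun w => F (Fin.snoc w (s f - s g))).symm
      _ = ∑' g, ∑' l : {l // Interlaces l g ∧ Interlaces l g}, ∑' a, gtSum M n g fun w =>
            F (Fin.snoc w (a + ∑ i, w i - s l)) := by
          refine tsum_congr fun g => ?_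
          rw [← (growthEquiv g g).tsum_eq, ENNReal.tsum_prod']
          refine tsum_congr fun l => tsum_congr fun a => ?_
          by_cases hg : g M = 0
          · refine gtSum_congr _ _ _ fun w hw => ?_
            have h1 := sum_growthEquiv M hg hg (l, a)
            congr 2
            simp [s]; simp at h1; omega
          · rw [gtSum_eq_zero _ _ _ _ hM hg, gtSum_eq_zero _ _ _ _ hM hg]
      _ = ∑' l, ∑' g : {g // Interlaces l g}, ∑' a, gtSum M n g fun w =>
            F (Fin.snoc w (a + ∑ i, w i - s l)) := by
          refine .trans ?_ (ENNReal.tsum_comm_subtype Interlaces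
            fun l g => ∑' a, gtSum M n g fun w => F (Fin.snoc w (a + ∑ i, w i - s l))).symm
          exact tsum_congr fun g => (Equiv.subtypeEquivRight fun _ => and_self_iff).tsum_eq
            fun l : {l // Interlaces l g} =>
              ∑' a, gtSum M n g fun w => F (Fin.snoc w (a + ∑ i, w i - s l))
      _ = ∑' l, ∑' a, ∑' b : Fin n → ℕ, gtSum M n l fun w =>
            F (Fin.snoc (w + b) (a + ∑ i, b i)) := by
          refine tsum_congr fun l => ?_
          rw [ENNReal.tsum_comm]
          refine tsum_congr fun a => ?_
          rw [tsum_gtSum_interlaces M n hM l fun w => F (Fin.snoc w (a + ∑ i, w i - s l))]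
          refine tsum_congr fun b => gtSum_congr _ _ _ fun w hw => ?_
          congr 2
          simp [Finset.sum_add_distrib, hw, s]; omega
      _ = ∑' a, ∑' b : Fin n → ℕ, ∑' A : {A : Matrix (Fin n) (Fin n) ℕ // A.IsSymm},
            F (Fin.snoc ((fun i => ∑ j, A.1 i j) + b) (a + ∑ i, b i)) := by
          rw [ENNReal.tsum_comm]
          refine tsum_congr fun a => ?_
          rw [ENNReal.tsum_comm]
          exact tsum_congr fun b => ih (by omega) fun w => F (Fin.snoc (w + b) (a + ∑ i, b i))
      _ = _ := by
          rw [← (symmSnocEquiv n).tsum_eq, ENNReal.tsum_prod']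
          refine tsum_congr fun a => ?_
          rw [ENNReal.tsum_prod']
          refine tsum_congr fun b => tsum_congr fun A => ?_
          congr 1
          ext i
          induction i using Fin.lastCases <;>
            simp [symmSnocEquiv, symmSnoc, Fin.sum_univ_castSucc, add_comm]

lemma gtSum_eq_zero_of_not_antitone (M n : ℕ) (f : ℕ → ℕ) (F : (Fin n → ℕ) → ℝ≥0∞)
    (hf : ¬ Antitone f) : gtSum M n f F = 0 := by
  cases n with
  | zero =>
    rw [gtSum, if_neg]
    rintro rfl
    exact hf antitone_const
  | succ n =>
    rw [gtSum, ENNReal.tsum_eq_zero]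
    rintro ⟨g, hg⟩
    exact absurd (antitone_nat_of_succ_le fun i => (hg i).1.trans (hg i).2) hf

namespace YoungDiagram

lemma rowLen_injective : Function.Injective rowLen := fun μ ν h => by
  ext ⟨i, j⟩
  rw [mem_cells, mem_cells, mem_iff_lt_rowLen, mem_iff_lt_rowLen, h]

lemma exists_rowLen_eq {f : ℕ → ℕ} (hf : Antitone f) {N : ℕ} (hN : f N = 0) :
    ∃ μ : YoungDiagram, μ.rowLen = f := by
  have hmem : ∀ i j, j < f i → i < N ∧ j < f 0 := fun i j hj => by
    refine ⟨lt_of_not_ge fun h => ?_, hj.trans_le (hf (Nat.zero_le _))⟩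
    have := hf h
    omega
  refine ⟨⟨(Finset.range N ×ˢ Finset.range (f 0)).filter fun c => c.2 < f c.1, ?_⟩, ?_⟩
  · rintro ⟨i, j⟩ ⟨i', j'⟩ ⟨hi, hj⟩ h
    simp only [Finset.coe_filter, Finset.mem_product, Finset.mem_range, Set.mem_ofPred_eq] at h ⊢
    have h' : j' < f i' := lt_of_le_of_lt hj (h.2.trans_le (hf hi))
    exact ⟨hmem _ _ h', h'⟩
  · ext i
    refine eq_of_forall_lt_iff fun j => ?_
    rw [← mem_iff_lt_rowLen, ← mem_cells, Finset.mem_filter, Finset.mem_product, Finset.mem_range,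
      Finset.mem_range]
    exact ⟨fun h => h.2, fun h => ⟨hmem _ _ h, h⟩⟩

lemma card_eq_sum_rowLen (μ : YoungDiagram) {N : ℕ} (hN : μ.rowLen N = 0) :
    μ.card = ∑ i ∈ Finset.range N, μ.rowLen i := by
  simp_rw [rowLen_eq_card]
  refine Finset.card_eq_sum_card_fiberwise fun c hc => ?_
  refine Finset.mem_coe.2 (Finset.mem_range.2 (lt_of_not_ge fun h => ?_))
  have h1 := mem_iff_lt_rowLen.1 (show (c.1, c.2) ∈ μ from hc)
  have := μ.rowLen_anti _ _ h
  omega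

end YoungDiagram

namespace SemistandardYoungTableau

variable {μ lam : YoungDiagram}

/-- All entries of the tableau are smaller than `n`. -/
def EntriesLT (T : SemistandardYoungTableau μ) (n : ℕ) : Prop := ∀ c ∈ μ.cells, T c.1 c.2 < n

lemma EntriesLT.rowLen_eq_zero {T : SemistandardYoungTableau μ} {n : ℕ} (hT : T.EntriesLT n)
    {i : ℕ} (hi : n ≤ i) : μ.rowLen i = 0 := by
  by_contra h
  have hmem : ∀ k ≤ i, (k, 0) ∈ μ := fun k hk => μ.up_left_mem hk le_rfl
    (YoungDiagram.mem_iff_lt_rowLen.2 (Nat.pos_of_ne_zero h))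
  have hle : ∀ k ≤ i, k ≤ T k 0 := by
    intro k
    induction k with
    | zero => simp
    | succ k ih =>
      intro hk
      have := ih (by omega)
      have := T.col_strict (lt_add_one k) (hmem _ hk)
      omega
  have h1 := hle i le_rfl
  have : T i 0 < n := hT (i, 0) (hmem i le_rfl)
  omega

lemma EntriesLT.sum_ssytWeight {T : SemistandardYoungTableau μ} {n : ℕ} (hT : T.EntriesLT n) :
    ∑ i : Fin n, ssytWeight T i = μ.card := by
  rw [Fin.sum_univ_eq_sum_range (fun i => ssytWeight T i) n]
  exact (Finset.card_eq_sum_card_fiberwise (f := fun c => T c.1 c.2)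
    fun c hc => Finset.mem_coe.2 (Finset.mem_range.2 (hT c hc))).symm

/-- Extend a tableau with entries smaller than `n` by filling a horizontal strip with `n`. -/
def extend (h : Interlaces μ.rowLen lam.rowLen) {n : ℕ} (T : SemistandardYoungTableau μ)
    (hT : T.EntriesLT n) : SemistandardYoungTableau lam where
  entry i j := if (i, j) ∈ μ then T i j else if (i, j) ∈ lam then n else 0
  row_weak' {i j₁ j₂} hj hmem := by
    have h1 : (i, j₂) ∈ μ → (i, j₁) ∈ μ := μ.up_left_mem le_rfl hj.le
    have h2 : (i, j₁) ∈ μ → T i j₁ < n := hT (i, j₁)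
    have h3 : (i, j₂) ∈ μ → T i j₁ ≤ T i j₂ := T.row_weak hj
    split_ifs <;> grind
  col_strict' {i₁ i₂ j} hi hmem := by
    have h1 : (i₁, j) ∈ μ := by
      rw [YoungDiagram.mem_iff_lt_rowLen] at hmem ⊢
      exact hmem.trans_le ((lam.rowLen_anti _ _ hi).trans (h i₁).1)
    have h2 : T i₁ j < n := hT (i₁, j) h1
    have h3 : (i₂, j) ∈ μ → T i₁ j < T i₂ j := T.col_strict hi
    split_ifs <;> grind
  zeros' {i j} hij := by
    rw [if_neg, if_neg hij]
    rw [YoungDiagram.mem_iff_lt_rowLen] at hij ⊢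
    have := (h i).2
    omega

lemma extend_apply (h : Interlaces μ.rowLen lam.rowLen) {n : ℕ} (T : SemistandardYoungTableau μ)
    (hT : T.EntriesLT n) (i j : ℕ) :
    extend h T hT i j = if (i, j) ∈ μ then T i j else if (i, j) ∈ lam then n else 0 := rfl

lemma _root_.Interlaces.le (h : Interlaces μ.rowLen lam.rowLen) : μ ≤ lam := fun c hc =>
  YoungDiagram.mem_iff_lt_rowLen.2
    ((YoungDiagram.mem_iff_lt_rowLen.1 (show (c.1, c.2) ∈ μ from hc)).trans_le (h c.1).2)

lemma entriesLT_extend (h : Interlaces μ.rowLen lam.rowLen) {n : ℕ}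
    (T : SemistandardYoungTableau μ) (hT : T.EntriesLT n) : (extend h T hT).EntriesLT (n + 1) := by
  rintro ⟨i, j⟩ -
  have : (i, j) ∈ μ → T i j < n := hT (i, j)
  rw [extend_apply]
  split_ifs with h1
  · exact (this h1).trans (Nat.lt_succ_self n)
  all_goals omega

lemma mem_iff_extend_lt (h : Interlaces μ.rowLen lam.rowLen) {n : ℕ}
    (T : SemistandardYoungTableau μ) (hT : T.EntriesLT n) (i j : ℕ) :
    (i, j) ∈ μ ↔ (i, j) ∈ lam ∧ extend h T hT i j < n := by
  have h1 : (i, j) ∈ μ → T i j < n := hT (i, j)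
  have h2 : (i, j) ∈ μ → (i, j) ∈ lam := fun hm => h.le hm
  rw [extend_apply]
  split_ifs <;> grind

lemma ssytWeight_extend (h : Interlaces μ.rowLen lam.rowLen) {n : ℕ}
    (T : SemistandardYoungTableau μ) (hT : T.EntriesLT n) :
    (fun i : Fin (n + 1) => ssytWeight (extend h T hT) i) =
      Fin.snoc (α := fun _ => ℕ) (fun i : Fin n => ssytWeight T i) (lam.card - μ.card) := by
  ext i
  induction i using Fin.lastCases with
  | last =>
    rw [Fin.snoc_last, ← Finset.card_sdiff_of_subset (YoungDiagram.cells_subset_iff.2 h.le)]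
    refine congrArg Finset.card (Finset.ext fun ⟨i, j⟩ => ?_)
    have h1 := mem_iff_extend_lt h T hT i j
    have h2 := entriesLT_extend h T hT (i, j)
    simp only [Finset.mem_filter, Finset.mem_sdiff, YoungDiagram.mem_cells, Fin.val_last] at h2 ⊢
    constructor
    · rintro ⟨h3, h4⟩
      exact ⟨h3, fun h5 => by have := (h1.1 h5).2; omega⟩
    · rintro ⟨h3, h4⟩
      refine ⟨h3, ?_⟩
      have := h2 h3
      by_contra h5
      exact h4 (h1.2 ⟨h3, by omega⟩)
  | cast k =>
    rw [Fin.snoc_castSucc]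
    refine congrArg Finset.card (Finset.ext fun ⟨i, j⟩ => ?_)
    have h1 := mem_iff_extend_lt h T hT i j
    have h2 := extend_apply h T hT i j
    have h3 := k.2
    simp only [Finset.mem_filter, YoungDiagram.mem_cells, Fin.val_castSucc]
    constructor
    · rintro ⟨h4, h5⟩
      have h6 := h1.2 ⟨h4, by omega⟩
      rw [if_pos h6] at h2
      exact ⟨h6, by omega⟩
    · rintro ⟨h4, h5⟩
      rw [if_pos h4] at h2
      exact ⟨(h1.1 h4).1, by omega⟩

lemma extend_bijective (lam : YoungDiagram) (n : ℕ) :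
    Function.Bijective fun x : Σ μ : {μ : YoungDiagram // Interlaces μ.rowLen lam.rowLen},
        {T : SemistandardYoungTableau μ.1 // T.EntriesLT n} =>
      (⟨extend x.1.2 x.2.1 x.2.2, entriesLT_extend _ _ _⟩ :
        {T : SemistandardYoungTableau lam // T.EntriesLT (n + 1)}) := by
  constructor
  · rintro ⟨⟨μ, hμ⟩, T, hT⟩ ⟨⟨ν, hν⟩, S, hS⟩ h
    have h : extend hμ T hT = extend hν S hS := congrArg Subtype.val h
    obtain rfl : μ = ν := by
      ext ⟨i, j⟩
      rw [YoungDiagram.mem_cells, YoungDiagram.mem_cells, mem_iff_extend_lt hμ T hT,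
        mem_iff_extend_lt hν S hS, h]
    obtain rfl : T = S := by
      ext i j
      have h1 := congrArg (fun R : SemistandardYoungTableau lam => R i j) h
      simp only [extend_apply] at h1
      by_cases hij : (i, j) ∈ μ
      · simpa [hij] using h1
      · rw [T.zeros hij, S.zeros hij]
    rfl
  · rintro ⟨T, hT⟩
    let μ : YoungDiagram := ⟨lam.cells.filter fun c => T c.1 c.2 < n, by
      rintro ⟨i, j⟩ ⟨i', j'⟩ ⟨hi, hj⟩ h
      simp only [Finset.coe_filter, YoungDiagram.mem_cells, Set.mem_ofPred_eq] at h ⊢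
      refine ⟨lam.up_left_mem hi hj h.1, lt_of_le_of_lt ?_ h.2⟩
      exact (T.row_weak_of_le hj (lam.up_left_mem hi le_rfl h.1)).trans (T.col_weak hi h.1)⟩
    have hmem : ∀ i j, (i, j) ∈ μ ↔ (i, j) ∈ lam ∧ T i j < n := fun i j => by
      rw [← YoungDiagram.mem_cells, Finset.mem_filter, YoungDiagram.mem_cells]
    have hμ : Interlaces μ.rowLen lam.rowLen := fun i => by
      constructor <;> refine le_of_forall_lt fun j hj => ?_ <;>
        rw [← YoungDiagram.mem_iff_lt_rowLen] at hj ⊢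
      · have h1 := T.col_strict (lt_add_one i) hj
        have h2 : T (i + 1) j < n + 1 := hT (i + 1, j) hj
        exact (hmem i j).2 ⟨lam.up_left_mem (Nat.le_succ i) le_rfl hj, by omega⟩
      · exact ((hmem i j).1 hj).1
    let S : SemistandardYoungTableau μ :=
      { entry := fun i j => if (i, j) ∈ μ then T i j else 0
        row_weak' := fun {i j₁ j₂} hj h => by
          rw [if_pos (μ.up_left_mem le_rfl hj.le h), if_pos h]
          exact T.row_weak hj ((hmem _ _).1 h).1
        col_strict' := fun {i₁ i₂ j} hi h => by
          rw [if_pos (μ.up_left_mem hi.le le_rfl h), if_pos h]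
          exact T.col_strict hi ((hmem _ _).1 h).1
        zeros' := fun h => if_neg h }
    have hS_apply : ∀ i j, S i j = if (i, j) ∈ μ then T i j else 0 := fun _ _ => rfl
    have hS : S.EntriesLT n := by
      rintro ⟨i, j⟩ h
      have h : (i, j) ∈ μ := h
      simp only [hS_apply, if_pos h]
      exact ((hmem i j).1 h).2
    refine ⟨⟨⟨μ, hμ⟩, S, hS⟩, Subtype.ext (SemistandardYoungTableau.ext fun i j => ?_)⟩
    have h1 : (i, j) ∈ lam → T i j < n + 1 := hT (i, j)
    have h2 : (i, j) ∉ lam → T i j = 0 := T.zeros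
    have h3 := hmem i j
    simp only [extend_apply, hS_apply]
    split_ifs <;> grind

end SemistandardYoungTableau

open SemistandardYoungTableau

/-- The correspondence between Gelfand–Tsetlin patterns and semistandard tableaux. -/
lemma gtSum_rowLen (M n : ℕ) (hn : n ≤ M + 1) (lam : YoungDiagram) (F : (Fin n → ℕ) → ℝ≥0∞) :
    gtSum M n lam.rowLen F =
      ∑' T : {T : SemistandardYoungTableau lam // T.EntriesLT n},
        F fun i => ssytWeight T.1 (i : ℕ) := by
  induction n generalizing lam with
  | zero =>
    rw [gtSum]
    split_ifs with h
    · have hlam : ∀ c, c ∉ lam := fun c hc => by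
        have := YoungDiagram.mem_iff_lt_rowLen.1 (show (c.1, c.2) ∈ lam from hc)
        simp [h] at this
      rw [tsum_eq_single ⟨default, fun c hc => (hlam c hc).elim⟩]
      · exact congrArg F (Subsingleton.elim _ _)
      · rintro ⟨T, hT⟩ hne
        refine absurd (Subtype.ext (SemistandardYoungTableau.ext fun i j => ?_)) hne
        rw [T.zeros (hlam _), SemistandardYoungTableau.zeros _ (hlam _)]
    · rw [eq_comm, ENNReal.tsum_eq_zero]
      rintro ⟨T, hT⟩
      exact absurd (funext fun i => hT.rowLen_eq_zero (Nat.zero_le _)) h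
  | succ n ih =>
    let s : (ℕ → ℕ) → ℕ := fun f => ∑ i ∈ Finset.range (M + 1), f i
    have hbij : Function.Bijective
        fun μ : {μ : YoungDiagram // Interlaces μ.rowLen lam.rowLen} =>
          (⟨μ.1.rowLen, μ.2⟩ : {g // Interlaces g lam.rowLen}) := by
      constructor
      · intro μ ν h
        exact Subtype.ext (YoungDiagram.rowLen_injective (congrArg Subtype.val h))
      · rintro ⟨g, hg⟩
        obtain ⟨N, hN⟩ := YoungDiagram.exists_notMem_col lam 0
        rw [YoungDiagram.mem_cells, YoungDiagram.mem_iff_lt_rowLen] at hN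
        obtain ⟨μ, rfl⟩ := YoungDiagram.exists_rowLen_eq (f := g) (N := N)
          (antitone_nat_of_succ_le fun i => (hg (i + 1)).2.trans (hg i).1)
          (by have := (hg N).2; omega)
        exact ⟨⟨μ, hg⟩, rfl⟩
    calc gtSum M (n + 1) lam.rowLen F
        = ∑' g : {g // Interlaces g lam.rowLen}, gtSum M n g fun w =>
            F (Fin.snoc w (s lam.rowLen - s g)) := rfl
      _ = ∑' μ : {μ : YoungDiagram // Interlaces μ.rowLen lam.rowLen},
            gtSum M n μ.1.rowLen fun w => F (Fin.snoc w (s lam.rowLen - s μ.1.rowLen)) :=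
          ((Equiv.ofBijective _ hbij).tsum_eq _).symm
      _ = ∑' μ : {μ : YoungDiagram // Interlaces μ.rowLen lam.rowLen},
            ∑' T : {T : SemistandardYoungTableau μ.1 // T.EntriesLT n},
              F (Fin.snoc (fun i : Fin n => ssytWeight T.1 (i : ℕ))
                (s lam.rowLen - s μ.1.rowLen)) :=
          tsum_congr fun μ => ih (by omega) μ.1 _
      _ = _ := by
          rw [← (Equiv.ofBijective _ (extend_bijective lam n)).tsum_eq, ENNReal.tsum_sigma']
          refine tsum_congr fun μ => tsum_congr fun T => congrArg F ?_
          have h1 := (entriesLT_extend μ.2 T.1 T.2).rowLen_eq_zero hn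
          have h2 := (μ.2 (M + 1)).2
          rw [Equiv.ofBijective_apply, ssytWeight_extend, lam.card_eq_sum_rowLen h1,
            μ.1.card_eq_sum_rowLen (N := M + 1) (by omega)]

lemma tsum_ssytWeight_eq_tsum_symm (n : ℕ) (F : (Fin n → ℕ) → ℝ≥0∞) :
    ∑' x : Σ lam : YoungDiagram, {T : SemistandardYoungTableau lam // T.EntriesLT n},
        F (fun i => ssytWeight x.2.1 (i : ℕ)) =
      ∑' A : {A : Matrix (Fin n) (Fin n) ℕ // A.IsSymm}, F fun i => ∑ j, A.1 i j := by
  rw [← tsum_gtSum n n (by omega), ENNReal.tsum_sigma',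
    ← YoungDiagram.rowLen_injective.tsum_eq (f := fun f => gtSum n n f F)]
  · exact tsum_congr fun lam => (gtSum_rowLen n n (by omega) lam F).symm
  · intro f hf
    refine YoungDiagram.exists_rowLen_eq (N := n) ?_ ?_ <;> by_contra h
    · exact hf (gtSum_eq_zero_of_not_antitone _ _ _ _ h)
    · exact hf (gtSum_eq_zero _ _ _ _ le_rfl h)

lemma ENNReal.tsum_indicator_comp {X W : Type*} (f : X → W) (s : Set W) :
    ∑' x, s.indicator (1 : W → ℝ≥0∞) (f x) = ((f ⁻¹' s).encard : ℝ≥0∞) := by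
  rw [← ENNReal.tsum_set_one, tsum_subtype (f ⁻¹' s) fun _ => (1 : ℝ≥0∞)]
  rfl

lemma exists_equiv_of_tsum_comp_eq {X Y W : Type*} (f : X → W) (g : Y → W)
    (hg : ∀ w, (g ⁻¹' {w}).Finite)
    (h : ∀ F : W → ℝ≥0∞, ∑' x, F (f x) = ∑' y, F (g y)) : ∃ e : X ≃ Y, ∀ x, g (e x) = f x := by
  have hcard : ∀ w, (f ⁻¹' {w}).encard = (g ⁻¹' {w}).encard := fun w => by
    have := h (Set.indicator {w} 1)
    rw [ENNReal.tsum_indicator_comp, ENNReal.tsum_indicator_comp] at this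
    exact_mod_cast this
  have hequiv : ∀ w, Nonempty ({x // f x = w} ≃ {y // g y = w}) := fun w => by
    have hf : (f ⁻¹' {w}).Finite := by
      rw [← Set.encard_lt_top_iff, hcard, Set.encard_lt_top_iff]
      exact hg w
    have := hf.to_subtype
    have := (hg w).to_subtype
    refine (Finite.card_eq (α := f ⁻¹' {w}) (β := g ⁻¹' {w})).1 ?_
    rw [Nat.card_coe_set_eq, Nat.card_coe_set_eq, Set.ncard_def, Set.ncard_def, hcard w]
  let e := fun w => (hequiv w).some
  refine ⟨(Equiv.sigmaFiberEquiv f).symm.trans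
    ((Equiv.sigmaCongrRight e).trans (Equiv.sigmaFiberEquiv g)), fun x => ?_⟩
  exact (e (f x) ⟨x, rfl⟩).2

lemma finsum_sigma_of_finite_support {α M : Type*} {β : α → Type*} [AddCommMonoid M]
    (f : (Σ a, β a) → M) (hf : (Function.support f).Finite) :
    ∑ᶠ x, f x = ∑ᶠ a, ∑ᶠ b, f ⟨a, b⟩ := by
  classical
  let t : Finset α := hf.toFinset.image Sigma.fst
  let u : ∀ a, Finset (β a) := fun a =>
    hf.toFinset.preimage (Sigma.mk a) (sigma_mk_injective.injOn)
  have hu : ∀ a, ∑ᶠ b, f ⟨a, b⟩ = ∑ b ∈ u a, f ⟨a, b⟩ := fun a =>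
    finsum_eq_sum_of_support_subset _ fun b hb => by simpa [u] using hb
  simp_rw [hu]
  rw [finsum_eq_sum_of_support_subset (s := t.sigma u), Finset.sum_sigma,
    finsum_eq_sum_of_support_subset (s := t)]
  · intro a ha
    obtain ⟨b, hb, -⟩ := Finset.exists_ne_zero_of_sum_ne_zero ha
    exact Finset.mem_coe.2 (Finset.mem_image.2 ⟨⟨a, b⟩, by simpa [u] using hb, rfl⟩)
  · rintro ⟨a, b⟩ hx
    have hx : f ⟨a, b⟩ ≠ 0 := hx
    exact Finset.mem_coe.2 (Finset.mem_sigma.2 ⟨Finset.mem_image.2 ⟨⟨a, b⟩, by simpa using hx, rfl⟩,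
      by simpa [u] using hx⟩)

lemma finite_setOf_sum_sum_eq (n d : ℕ) :
    {A : {A : Matrix (Fin n) (Fin n) ℕ // A.IsSymm} | ∑ i, ∑ j, A.1 i j = d}.Finite := by
  refine Set.Finite.preimage (Subtype.val_injective.injOn)
    (s := {A : Matrix (Fin n) (Fin n) ℕ | ∑ i, ∑ j, A i j = d}) ?_
  refine Set.Finite.subset (s := Set.Iic (α := Fin n → Fin n → ℕ) fun _ _ => d)
    (Set.finite_Iic _) fun A hA i j => ?_
  have hA : ∑ i, ∑ j, A i j = d := hA
  calc A i j ≤ ∑ j, A i j := Finset.single_le_sum (fun _ _ => Nat.zero_le _) (Finset.mem_univ j)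
    _ ≤ ∑ i, ∑ j, A i j :=
      Finset.single_le_sum (f := fun i => ∑ j, A i j) (fun _ _ => Nat.zero_le _) (Finset.mem_univ i)
    _ = d := hA

lemma prod_pow_mul_prod_lt_eq {R : Type*} [CommMonoid R] {n : ℕ} (x : Fin n → R)
    {A : Matrix (Fin n) (Fin n) ℕ} (hA : A.IsSymm) :
    (∏ i, x i ^ A i i) * ∏ p ∈ Finset.univ.filter (fun p : Fin n × Fin n => p.1 < p.2),
      (x p.1 * x p.2) ^ A p.1 p.2 = ∏ i, x i ^ ∑ j, A i j := by
  have hsplit : ∀ p : Fin n × Fin n, x p.1 ^ A p.1 p.2 =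
      (if p.1 = p.2 then x p.1 ^ A p.1 p.2 else 1) *
      ((if p.1 < p.2 then x p.1 ^ A p.1 p.2 else 1) *
        (if p.2 < p.1 then x p.1 ^ A p.1 p.2 else 1)) := fun p => by
    rcases lt_trichotomy p.1 p.2 with h | h | h
    · simp [h, h.ne, h.not_gt]
    · simp [h]
    · simp [h, h.ne', h.not_gt]
  simp_rw [← Finset.prod_pow_eq_pow_sum]
  rw [← Finset.prod_product', Finset.univ_product_univ, Finset.prod_congr rfl fun p _ => hsplit p,
    Finset.prod_mul_distrib, Finset.prod_mul_distrib]
  congr 1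
  · rw [Fintype.prod_prod_type]
    simp
  · have hswap : ∏ p : Fin n × Fin n, (if p.2 < p.1 then x p.1 ^ A p.1 p.2 else 1) =
        ∏ p : Fin n × Fin n, if p.1 < p.2 then x p.2 ^ A p.2 p.1 else 1 :=
      (Equiv.prod_comp (Equiv.prodComm (Fin n) (Fin n)) _).symm
    rw [hswap, ← Finset.prod_mul_distrib, Finset.prod_filter]
    refine Finset.prod_congr rfl fun p _ => ?_
    split_ifs
    · rw [mul_pow, hA.apply p.1 p.2]
    · rw [mul_one]

open MvPolynomial in
/-- **Gelfand model for GL_n, character identity.** The sum over symmetric `n × n` matrices `A`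
of nonnegative integers with total entry sum `d` of `∏_i x_i^{a_{ii}} ∏_{i<j} (x_i x_j)^{a_{ij}}`
equals `∑_{λ ⊢ d} s_λ(x_1,…,x_n)`. -/
theorem gelfand_model_characters (n d : ℕ) (hn : 0 < n) :
    ∑ᶠ (A : Matrix (Fin n) (Fin n) ℕ) (_ : A.IsSymm ∧ ∑ i, ∑ j, A i j = d),
        (∏ i : Fin n, (X i : MvPolynomial (Fin n) ℤ) ^ A i i) *
          ∏ p ∈ Finset.univ.filter (fun p : Fin n × Fin n => p.1 < p.2),
            ((X p.1 : MvPolynomial (Fin n) ℤ) * X p.2) ^ A p.1 p.2 =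
      ∑ᶠ (lam : YoungDiagram) (_ : lam.card = d), schurPoly n lam := by
  classical
  let m : (Fin n → ℕ) → MvPolynomial (Fin n) ℤ := fun w =>
    if ∑ i, w i = d then ∏ i, X i ^ w i else 0
  obtain ⟨e, he⟩ := exists_equiv_of_tsum_comp_eq
    (fun x : Σ lam : YoungDiagram, {T : SemistandardYoungTableau lam // T.EntriesLT n} =>
      fun i : Fin n => ssytWeight x.2.1 (i : ℕ))
    (fun A : {A : Matrix (Fin n) (Fin n) ℕ // A.IsSymm} => fun i => ∑ j, A.1 i j)
    (fun w => (finite_setOf_sum_sum_eq n (∑ i, w i)).subset fun A hA =>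
      congrArg (fun v : Fin n → ℕ => ∑ i, v i) hA)
    (tsum_ssytWeight_eq_tsum_symm n)
  have hfin : (Function.support fun A : {A : Matrix (Fin n) (Fin n) ℕ // A.IsSymm} =>
      m fun i => ∑ j, A.1 i j).Finite :=
    (finite_setOf_sum_sum_eq n d).subset fun A hA => by
      by_contra h
      exact hA (if_neg h)
  calc _ = ∑ᶠ (A : Matrix (Fin n) (Fin n) ℕ) (_ : A.IsSymm), m fun i => ∑ j, A i j := by
        refine finsum_congr fun A => ?_
        by_cases hA : A.IsSymm <;> by_cases hd : ∑ i, ∑ j, A i j = d <;> simp [m, hA, hd]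
        exact prod_pow_mul_prod_lt_eq _ hA
    _ = ∑ᶠ A : {A : Matrix (Fin n) (Fin n) ℕ // A.IsSymm}, m fun i => ∑ j, A.1 i j :=
        (finsum_subtype_eq_finsum_cond
          (f := fun A : Matrix (Fin n) (Fin n) ℕ => m fun i => ∑ j, A i j) _).symm
    _ = ∑ᶠ x : Σ lam : YoungDiagram, {T : SemistandardYoungTableau lam // T.EntriesLT n},
          m fun i => ssytWeight x.2.1 (i : ℕ) := by
        rw [← finsum_comp_equiv e]
        exact finsum_congr fun x => congrArg m (he x)
    _ = ∑ᶠ (lam : YoungDiagram) (T : {T : SemistandardYoungTableau lam // T.EntriesLT n}),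
          m fun i => ssytWeight T.1 (i : ℕ) := by
        refine finsum_sigma_of_finite_support _ ((hfin.preimage e.injective.injOn).subset ?_)
        intro x hx
        have hx : m (fun i => ssytWeight x.2.1 (i : ℕ)) ≠ 0 := hx
        rw [← he x] at hx
        exact hx
    _ = _ := by
        refine finsum_congr fun lam => ?_
        by_cases hd : lam.card = d
        · simp only [hd, finsum_true, schurPoly]
          refine (finsum_congr fun T => ?_).trans (finsum_subtype_eq_finsum_cond
            (f := fun T : SemistandardYoungTableau lam =>
              ∏ i : Fin n, (X i : MvPolynomial (Fin n) ℤ) ^ ssytWeight T (i : ℕ))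
            fun T => T.EntriesLT n)
          exact if_pos (T.2.sum_ssytWeight.trans hd)
        · simp only [hd, finsum_false]
          exact finsum_eq_zero_of_forall_eq_zero fun T =>
            if_neg (T.2.sum_ssytWeight.trans_ne hd)
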